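/- Let α : (0,∞) → (0,∞) be differentiable and let u : ℝ × (0,∞) → ℝ be smooth, such that for every t the functions x ↦ u(x,t), x ↦ ∂u/∂x(x,t), x ↦ ∂²u/∂x²(x,t) and x ↦ ∂u/∂t(x,t) are Schwartz functions on ℝ. For each natural number m define û_m(t) = (α(t)/(2^m m!)) ∫_ℝ u(x,t) H_m(α(t)x) dx and f̂_m(t) = (α(t)/(2^m m!)) ∫_ℝ (∂u/∂t − ∂²u/∂x²)(x,t) H_m(α(t)x) dx, with the convention û_m ≡ 0 for m < 0. Assume moreover that for each m the function û_m is differentiable and its derivative may be computed by differentiating under the integral sign: û_m′(t) = (1/(2^m m!)) ∫_ℝ ∂/∂t [α(t) u(x,t) H_m(α(t)x)] dx. Then for every m ≥ 0 and every t > 0: û_m′(t) − (α′(t)/(2α(t)) + α(t)²) û_{m-2}(t) − (m+1)(α′(t)/α(t)) û_m(t) = f̂_m(t). -/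

import Mathlib

/-- Physicists' Hermite polynomials, defined by the three-term recurrence
`H_0 = 1`, `H_1(ζ) = 2ζ`, `H_{n+1}(ζ) = 2ζ H_n(ζ) - 2n H_{n-1}(ζ)`. -/
noncomputable def physHermite : ℕ → ℝ → ℝ
  | 0, _ => 1
  | 1, x => 2 * x
  | n + 2, x => 2 * x * physHermite (n + 1) x - 2 * ((n:ℝ) + 1) * physHermite n x

/-- The three-term recurrence for `physHermite`, valid for all `n` with truncated subtraction. -/
theorem physHermite_succ (n : ℕ) (x : ℝ) :
    physHermite (n + 1) x = 2 * x * physHermite n x - 2 * (n : ℝ) * physHermite (n - 1) x := by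
  cases n with
  | zero => simp [physHermite]
  | succ k => simp [physHermite]

theorem hasDerivAt_physHermite (n : ℕ) (x : ℝ) :
    HasDerivAt (physHermite n) (2 * (n : ℝ) * physHermite (n - 1) x) x := by
  induction n using Nat.twoStepInduction with
  | zero => simpa [physHermite] using hasDerivAt_const x (1 : ℝ)
  | one => simpa [physHermite] using (hasDerivAt_id x).const_mul (2 : ℝ)
  | more n ih ih' =>
    have h := (((hasDerivAt_id x).const_mul 2).mul ih').sub (ih.const_mul (2 * ((n : ℝ) + 1)))
    refine h.congr_deriv ?_
    have hr := physHermite_succ n x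
    simp only [Nat.add_sub_cancel, id, Nat.add_succ_sub_one]
    push_cast
    linear_combination -2 * ((n : ℝ) + 1) * hr

theorem mul_deriv_physHermite (n : ℕ) (x : ℝ) :
    x * (2 * (n : ℝ) * physHermite (n - 1) x) =
      n * physHermite n x + 2 * (n : ℝ) * ((n - 1 : ℕ) : ℝ) * physHermite (n - 2) x := by
  cases n with
  | zero => simp
  | succ k =>
    have hr := physHermite_succ k x
    rw [Nat.add_sub_cancel, show k + 1 - 2 = k - 1 by omega]
    push_cast
    linear_combination -((k : ℝ) + 1) * hr

theorem hasTemperateGrowth_physHermite (n : ℕ) : (physHermite n).HasTemperateGrowth := by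
  induction n using Nat.twoStepInduction with
  | zero => exact Function.HasTemperateGrowth.const (1 : ℝ)
  | one =>
    change Function.HasTemperateGrowth fun x : ℝ => 2 * x
    fun_prop
  | more n ih ih' =>
    change Function.HasTemperateGrowth fun x : ℝ =>
      2 * x * physHermite (n + 1) x - 2 * ((n : ℝ) + 1) * physHermite n x
    fun_prop

theorem integrable_schwartz_mul_physHermite (g : SchwartzMap ℝ ℝ) (n : ℕ) (a : ℝ) :
    MeasureTheory.Integrable fun x => g x * physHermite n (a * x) := by
  have hp := hasTemperateGrowth_physHermite n
  have h : Function.HasTemperateGrowth fun x : ℝ => physHermite n (a * x) :=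
    hp.comp (g := physHermite n) (f := fun x : ℝ => a * x) (by fun_prop)
  refine (SchwartzMap.smulLeftCLM ℝ (fun x : ℝ => physHermite n (a * x)) g).integrable.congr ?_
  refine Filter.Eventually.of_forall fun x => ?_
  simp [SchwartzMap.smulLeftCLM_apply_apply h, mul_comm]

theorem hasDerivAt_physHermite_const_mul (n : ℕ) (a x : ℝ) :
    HasDerivAt (fun y => physHermite n (a * y)) (2 * (n : ℝ) * physHermite (n - 1) (a * x) * a) x :=
  (hasDerivAt_physHermite n (a * x)).comp x (by simpa using (hasDerivAt_id x).const_mul a)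

theorem integral_deriv_schwartz_mul_physHermite (g : SchwartzMap ℝ ℝ) (n : ℕ) (a : ℝ) :
    ∫ x, deriv g x * physHermite n (a * x) =
      -(2 * (n : ℝ) * a) * ∫ x, g x * physHermite (n - 1) (a * x) := by
  have h := MeasureTheory.integral_mul_deriv_eq_deriv_mul_of_integrable
    (u := g) (u' := deriv g) (v := fun y => physHermite n (a * y))
    (v' := fun x => 2 * (n : ℝ) * physHermite (n - 1) (a * x) * a)
    (fun x _ => g.differentiableAt.hasDerivAt)
    (fun x _ => hasDerivAt_physHermite_const_mul n a x)
    (((integrable_schwartz_mul_physHermite g (n - 1) a).const_mul (2 * (n : ℝ) * a)).congr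
      (Filter.Eventually.of_forall fun x => by simp only [Pi.mul_apply]; ring))
    (integrable_schwartz_mul_physHermite (SchwartzMap.derivCLM ℝ ℝ g) n a)
    (integrable_schwartz_mul_physHermite g n a)
  rw [← neg_eq_iff_eq_neg] at h
  rw [← h, neg_mul, ← MeasureTheory.integral_const_mul]
  congr 2
  ext x
  ring

theorem integral_deriv_deriv_schwartz_mul_physHermite (g : SchwartzMap ℝ ℝ) (n : ℕ) (a : ℝ) :
    ∫ x, deriv (deriv g) x * physHermite n (a * x) =
      4 * (n : ℝ) * ((n - 1 : ℕ) : ℝ) * a ^ 2 * ∫ x, g x * physHermite (n - 2) (a * x) := by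
  have h := integral_deriv_schwartz_mul_physHermite (SchwartzMap.derivCLM ℝ ℝ g) n a
  have hd : ⇑(SchwartzMap.derivCLM ℝ ℝ g) = deriv g := rfl
  rw [hd, integral_deriv_schwartz_mul_physHermite g (n - 1) a, Nat.sub_sub] at h
  rw [h]
  ring

/-- The time derivative of `α(s) v(s) H_n(α(s) x)`, expressed without factors of `x`. -/
theorem hasDerivAt_mul_mul_physHermite {α v : ℝ → ℝ} {t α' v' : ℝ} (hα : HasDerivAt α α' t)
    (hv : HasDerivAt v v' t) (n : ℕ) (x : ℝ) :
    HasDerivAt (fun s => α s * v s * physHermite n (α s * x))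
      (((n : ℝ) + 1) * α' * (v t * physHermite n (α t * x)) +
        2 * (n : ℝ) * ((n - 1 : ℕ) : ℝ) * α' * (v t * physHermite (n - 2) (α t * x)) +
        α t * (v' * physHermite n (α t * x))) t := by
  have hp := (hasDerivAt_physHermite n (α t * x)).comp t (hα.mul_const x)
  refine ((hα.mul hv).mul hp).congr_deriv ?_
  have hr := mul_deriv_physHermite n (α t * x)
  simp only [Function.comp_apply, Pi.mul_apply]
  linear_combination α' * v t * hr

/-- Evolution law for the Hermite–Fourier coefficients of a solution with time-dependent
scaling factor `α(t)`: for `u` smooth and Schwartz in `x`, the coefficients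
`û_m(t) = (α(t)/(2^m m!)) ∫ u(x,t) H_m(α(t)x) dx` and the coefficients `f̂_m` of the
residual `f = ∂u/∂t − ∂²u/∂x²` satisfy
`û_m′ − (α′/(2α) + α²) û_{m−2} − (m+1)(α′/α) û_m = f̂_m`. -/
theorem hermite_coefficient_evolution
    (α : ℝ → ℝ) (hαpos : ∀ t, 0 < t → 0 < α t)
    (hα : ∀ t, 0 < t → DifferentiableAt ℝ α t)
    (u : ℝ → ℝ → ℝ)
    (hu_smooth : ContDiffOn ℝ (⊤ : ℕ∞) (fun q : ℝ × ℝ => u q.1 q.2) {q : ℝ × ℝ | 0 < q.2})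
    (hSchwartz : ∀ t, 0 < t →
      (∃ g : SchwartzMap ℝ ℝ, ∀ x, g x = u x t) ∧
      (∃ g : SchwartzMap ℝ ℝ, ∀ x, g x = deriv (fun y => u y t) x) ∧
      (∃ g : SchwartzMap ℝ ℝ, ∀ x, g x = deriv (deriv (fun y => u y t)) x) ∧
      (∃ g : SchwartzMap ℝ ℝ, ∀ x, g x = deriv (fun s => u x s) t))
    (uh fh : ℤ → ℝ → ℝ)
    (huh : ∀ (m : ℕ) (t : ℝ), 0 < t → uh m t =
      (α t / (2 ^ m * (Nat.factorial m : ℝ))) *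
        ∫ x : ℝ, u x t * physHermite m (α t * x))
    (huh_neg : ∀ m : ℤ, m < 0 → ∀ t : ℝ, uh m t = 0)
    (hfh : ∀ (m : ℕ) (t : ℝ), 0 < t → fh m t =
      (α t / (2 ^ m * (Nat.factorial m : ℝ))) *
        ∫ x : ℝ, (deriv (fun s => u x s) t - deriv (deriv (fun y => u y t)) x) *
          physHermite m (α t * x))
    (hdiff : ∀ (m : ℕ) (t : ℝ), 0 < t → HasDerivAt (uh m)
      ((1 / (2 ^ m * (Nat.factorial m : ℝ))) *
        ∫ x : ℝ, deriv (fun s => α s * u x s * physHermite m (α s * x)) t) t) :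
    ∀ (m : ℕ) (t : ℝ), 0 < t →
      deriv (uh m) t - (deriv α t / (2 * α t) + (α t) ^ 2) * uh ((m:ℤ) - 2) t -
        ((m:ℝ) + 1) * (deriv α t / α t) * uh m t = fh m t := by
  intro m t ht
  have ha : α t ≠ 0 := (hαpos t ht).ne'
  obtain ⟨⟨g, hg⟩, -, -, ⟨k, hk⟩⟩ := hSchwartz t ht
  have hgu : (fun y => u y t) = ⇑g := funext fun x => (hg x).symm
  have hut : ∀ x, HasDerivAt (fun s => u x s) (k x) t := by
    intro x
    rw [hk x]
    have hnhds : {q : ℝ × ℝ | 0 < q.2} ∈ nhds (x, t) :=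
      (isOpen_lt continuous_const continuous_snd).mem_nhds ht
    have hd : DifferentiableAt ℝ (fun q : ℝ × ℝ => u q.1 q.2) (x, t) :=
      (hu_smooth.contDiffAt hnhds).differentiableAt (by simp)
    have hline : DifferentiableAt ℝ (fun s : ℝ => (x, s)) t := by fun_prop
    exact (DifferentiableAt.comp t hd hline).hasDerivAt
  have hI := integrable_schwartz_mul_physHermite g m (α t)
  have hJ := integrable_schwartz_mul_physHermite g (m - 2) (α t)
  have hK := integrable_schwartz_mul_physHermite k m (α t)
  have hL := integrable_schwartz_mul_physHermite
    (SchwartzMap.derivCLM ℝ ℝ (SchwartzMap.derivCLM ℝ ℝ g)) m (α t)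
  have hderiv : ∫ x : ℝ, deriv (fun s => α s * u x s * physHermite m (α s * x)) t =
      ((m : ℝ) + 1) * deriv α t * (∫ x, g x * physHermite m (α t * x)) +
        2 * (m : ℝ) * ((m - 1 : ℕ) : ℝ) * deriv α t *
          (∫ x, g x * physHermite (m - 2) (α t * x)) +
        α t * ∫ x, k x * physHermite m (α t * x) := by
    simp_rw [fun x => (hasDerivAt_mul_mul_physHermite (hα t ht).hasDerivAt (hut x) m x).deriv,
      ← hg]
    rw [MeasureTheory.integral_add (by exact (hI.const_mul _).add (hJ.const_mul _)) (hK.const_mul _),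
      MeasureTheory.integral_add (hI.const_mul _) (hJ.const_mul _)]
    simp only [MeasureTheory.integral_const_mul]
  have hres : ∫ x : ℝ, (deriv (fun s => u x s) t - deriv (deriv (fun y => u y t)) x) *
      physHermite m (α t * x) = (∫ x, k x * physHermite m (α t * x)) -
        4 * (m : ℝ) * ((m - 1 : ℕ) : ℝ) * α t ^ 2 *
          ∫ x, g x * physHermite (m - 2) (α t * x) := by
    rw [← integral_deriv_deriv_schwartz_mul_physHermite, hgu]
    simp_rw [← hk, sub_mul]
    exact MeasureTheory.integral_sub hK hL
  rw [(hdiff m t ht).deriv, hfh m t ht, huh m t ht, hderiv, hres]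
  simp_rw [← hg]
  rcases lt_or_ge m 2 with hm | hm
  · rw [huh_neg _ (by omega) t]
    have hz : (m : ℝ) * ((m - 1 : ℕ) : ℝ) = 0 := by interval_cases m <;> simp
    simp only [mul_assoc _ (m : ℝ), hz]
    field_simp
    ring
  · obtain ⟨n, rfl⟩ := Nat.exists_eq_add_of_le' hm
    rw [show ((n + 2 : ℕ) : ℤ) - 2 = (n : ℤ) by push_cast; ring, huh n t ht]
    simp_rw [← hg]
    have hf : (Nat.factorial n : ℝ) ≠ 0 := by positivity
    rw [show n + 2 - 1 = n + 1 by omega, Nat.add_sub_cancel, Nat.factorial_succ,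
      Nat.factorial_succ, pow_add]
    push_cast
    have h1 : (n : ℝ) + 1 ≠ 0 := by positivity
    have h2 : (n : ℝ) + 1 + 1 ≠ 0 := by positivity
    field_simp
    ring
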